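/- Let r ≥ 1, and let F_X and F_Y be distribution functions with finite absolute r-th moments. For any pair (X,Y) of random variables with marginal distribution functions F_X and F_Y, one has E|X − Y|^r ≥ E|X* − Y*|^r, where X* = F_X^{-1}(U), Y* = F_Y^{-1}(U) for a single uniform random variable U on (0,1) (F^{-1} denoting the quantile function). Moreover, if r > 1, equality holds only if (X,Y) has the same joint distribution as (X*, Y*). In particular the quantile coupling attains the infimum defining the Mallows r-distance. -/

import Mathlib

open MeasureTheory ProbabilityTheory Filter
open scoped ENNReal NNReal

noncomputable section

/-- The Mallows `r`-distance between two probability measures on `ℝ`: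
the infimum over couplings `π` of `(∫ |x - y|^r dπ)^(1/r)`, valued in `ℝ≥0∞`. -/
def mallows (r : ℝ) (μ ν : Measure ℝ) : ℝ≥0∞ :=
  (⨅ π ∈ {π : Measure (ℝ × ℝ) | π.map Prod.fst = μ ∧ π.map Prod.snd = ν},
    ∫⁻ p, ENNReal.ofReal (|p.1 - p.2| ^ r) ∂π) ^ (1 / r)

/-- The (left-continuous) quantile function of a distribution function `F`. -/
def quantileFn (F : ℝ → ℝ) (u : ℝ) : ℝ := sInf {x | u ≤ F x}

lemma qc_and {α : Type*} [MeasurableSpace α] {p q : α → Prop} (h : MeasurableSet {a | p a})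
    (h' : MeasurableSet {a | q a}) : MeasurableSet {a | p a ∧ q a} := h.inter h'

lemma qc_lint (p : ℝ) (hp : 0 < p) (a b : ℝ) (hab : a ≤ b) :
    ∫⁻ t in Set.Ioo a b, ENNReal.ofReal (p * (t - a) ^ (p - 1)) = ENNReal.ofReal ((b - a) ^ p) := by
  have h1 : IntervalIntegrable (fun t : ℝ => t ^ (p - 1)) volume 0 (b - a) :=
    intervalIntegral.intervalIntegrable_rpow' (by linarith)
  have h2 : IntervalIntegrable (fun t : ℝ => p * (t - a) ^ (p - 1)) volume a b := by
    have := (h1.comp_sub_right a).const_mul p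
    simpa using this
  rw [← ofReal_integral_eq_lintegral_ofReal]
  · rw [← integral_Ioc_eq_integral_Ioo, ← intervalIntegral.integral_of_le hab]
    rw [intervalIntegral.integral_const_mul,
      intervalIntegral.integral_comp_sub_right (fun t : ℝ => t ^ (p - 1)) a,
      integral_rpow (Or.inl (by linarith))]
    simp [Real.zero_rpow hp.ne']
    field_simp
  · exact ((intervalIntegrable_iff_integrableOn_Ioc_of_le hab).1 h2).mono_set Set.Ioo_subset_Ioc_self
  · refine (ae_restrict_iff' measurableSet_Ioo).2 (ae_of_all _ fun t ht => ?_)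
    have : 0 ≤ t - a := by linarith [ht.1]
    simp only [Pi.zero_apply]
    positivity

lemma qc_lint' (p : ℝ) (hp : 0 < p) (a b : ℝ) (hab : a ≤ b) :
    ∫⁻ t in Set.Ioo a b, ENNReal.ofReal (p * (b - t) ^ (p - 1)) = ENNReal.ofReal ((b - a) ^ p) := by
  have h := qc_lint p hp (-b) (-a) (by linarith)
  rw [show -a - -b = b - a by ring] at h
  rw [← h]
  have := (Measure.measurePreserving_neg (volume : Measure ℝ)).setLIntegral_comp_preimage_emb
    (MeasurableEquiv.neg ℝ).measurableEmbedding
    (fun t => ENNReal.ofReal (p * (t - -b) ^ (p - 1))) (Set.Ioo (-b) (-a))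
  rw [← this]
  congr 1
  · congr 1
    ext x; simp [and_comm]
  · ext t; congr 3; ring

def qcJ (p q : ℝ × ℝ) : ℝ≥0∞ :=
  (if p.1 ≤ q.1 ∧ q.2 < p.2 then 1 else 0) + (if p.2 ≤ q.1 ∧ q.2 < p.1 then 1 else 0)

lemma qcJ_swap (a b : ℝ) (q : ℝ × ℝ) : qcJ (a, b) q = qcJ (b, a) q := by
  simp only [qcJ]; rw [add_comm]

def qcDens (r : ℝ) (q : ℝ × ℝ) : ℝ≥0∞ :=
  if q.1 < q.2 then ENNReal.ofReal (r * (r - 1) * (q.2 - q.1) ^ (r - 2)) else 0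

lemma qcDens_meas (r : ℝ) : Measurable (qcDens r) := by
  unfold qcDens
  exact Measurable.ite (measurableSet_lt measurable_fst measurable_snd) (by fun_prop) measurable_const

lemma qcJ_meas : Measurable (fun z : (ℝ × ℝ) × (ℝ × ℝ) => qcJ z.1 z.2) := by
  unfold qcJ
  refine Measurable.add (Measurable.ite ?_ measurable_const measurable_const)
    (Measurable.ite ?_ measurable_const measurable_const)
  · exact qc_and (measurableSet_le (by fun_prop) (by fun_prop))
      (measurableSet_lt (by fun_prop) (by fun_prop))
  · exact qc_and (measurableSet_le (by fun_prop) (by fun_prop))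
      (measurableSet_lt (by fun_prop) (by fun_prop))

lemma qcJ_one (p : ℝ × ℝ) :
    ENNReal.ofReal (|p.1 - p.2| ^ (1 : ℝ)) =
      ∫⁻ q, qcJ p q ∂(Measure.map (fun s : ℝ => (s, s)) volume) := by
  obtain ⟨a, b⟩ := p
  wlog hab : a ≤ b generalizing a b
  · have := this b a (by linarith)
    simp only at this ⊢
    rw [abs_sub_comm, this]
    simp_rw [qcJ_swap]
  have hJ : Measurable (qcJ (a, b)) := qcJ_meas.comp (measurable_const.prodMk measurable_id)
  rw [lintegral_map hJ (by fun_prop)]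
  have : ∀ s : ℝ, qcJ (a, b) (s, s) = (Set.Ico a b).indicator 1 s := by
    intro s
    simp only [qcJ, Set.indicator, Set.mem_Ico]
    have : ¬ (b ≤ s ∧ s < a) := by intro h; linarith [h.1, h.2]
    simp [this]
  simp_rw [this]
  rw [lintegral_indicator_one measurableSet_Ico, Real.volume_Ico, abs_sub_comm,
    abs_of_nonneg (by simp; linarith), Real.rpow_one]

lemma qcJ_gt (r : ℝ) (hr : 1 < r) (p : ℝ × ℝ) :
    ENNReal.ofReal (|p.1 - p.2| ^ r) =
      ∫⁻ q, qcJ p q ∂((volume : Measure (ℝ × ℝ)).withDensity (qcDens r)) := by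
  obtain ⟨a, b⟩ := p
  wlog hab : a ≤ b generalizing a b
  · have := this b a (by linarith)
    simp only at this ⊢
    rw [abs_sub_comm, this]
    simp_rw [qcJ_swap]
  have hJ : Measurable (qcJ (a, b)) := qcJ_meas.comp (measurable_const.prodMk measurable_id)
  rw [lintegral_withDensity_eq_lintegral_mul _ (qcDens_meas r) hJ, Measure.volume_eq_prod,
    lintegral_prod _ ((qcDens_meas r).mul hJ).aemeasurable]
  have key : ∀ s : ℝ, ∫⁻ t, (qcDens r * qcJ (a, b)) (s, t) =
      (Set.Ico a b).indicator (fun s => ENNReal.ofReal (r * (b - s) ^ (r - 1))) s := by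
    intro s
    by_cases hs : s ∈ Set.Ico a b
    · rw [Set.indicator_of_mem hs, ENNReal.ofReal_mul (by linarith),
        ← qc_lint (r - 1) (by linarith) s b hs.2.le,
        ← lintegral_const_mul _ (by fun_prop), ← lintegral_indicator measurableSet_Ioo]
      congr 1
      ext t
      simp only [Pi.mul_apply, qcDens, qcJ, Set.indicator, Set.mem_Ioo]
      have h1 : ¬ (b ≤ s ∧ t < a) := by intro h; linarith [h.1, hs.2]
      simp only [h1, hs.1]
      by_cases h2 : s < t <;> by_cases h3 : t < b <;> simp [h2, h3]
      rw [← ENNReal.ofReal_mul (by linarith), mul_assoc]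
      congr 4
      ring
    · rw [Set.indicator_of_notMem hs, lintegral_eq_zero_iff (by
        exact ((qcDens_meas r).mul hJ).comp (measurable_const.prodMk measurable_id))]
      refine ae_of_all _ fun t => ?_
      simp only [Pi.mul_apply, qcDens, qcJ, Pi.zero_apply]
      simp only [Set.mem_Ico, not_and, not_lt] at hs
      by_cases h2 : s < t
      · have h1 : ¬ (b ≤ s ∧ t < a) := by intro h; linarith [h.1, h.2]
        have h3 : ¬ (a ≤ s ∧ t < b) := by intro h; linarith [hs h.1, h.2]
        simp [h1, h3]
      · simp [h2]
  simp_rw [key]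
  rw [lintegral_indicator measurableSet_Ico, ← setLIntegral_congr Ioo_ae_eq_Ico,
    qc_lint' r (by linarith) a b hab, abs_sub_comm, abs_of_nonneg (by simp; linarith)]

def qcD (π : Measure (ℝ × ℝ)) (q : ℝ × ℝ) : ℝ≥0∞ :=
  (π.map Prod.fst (Set.Iic q.1) - π (Set.Iic q.1 ×ˢ Set.Iic q.2)) +
  (π.map Prod.snd (Set.Iic q.1) - π (Set.Iic q.2 ×ˢ Set.Iic q.1))

lemma qc_cost (r : ℝ) (m : Measure (ℝ × ℝ)) [SFinite m]
    (hm : ∀ p : ℝ × ℝ, ENNReal.ofReal (|p.1 - p.2| ^ r) = ∫⁻ q, qcJ p q ∂m)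
    (π : Measure (ℝ × ℝ)) [IsFiniteMeasure π] :
    ∫⁻ p, ENNReal.ofReal (|p.1 - p.2| ^ r) ∂π = ∫⁻ q, qcD π q ∂m := by
  simp_rw [hm]
  rw [lintegral_lintegral_swap qcJ_meas.aemeasurable]
  congr 1
  ext ⟨s, t⟩
  have hA : MeasurableSet {p : ℝ × ℝ | p.1 ≤ s ∧ t < p.2} :=
    qc_and (measurableSet_le (by fun_prop) (by fun_prop))
      (measurableSet_lt (by fun_prop) (by fun_prop))
  have hB : MeasurableSet {p : ℝ × ℝ | p.2 ≤ s ∧ t < p.1} :=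
    qc_and (measurableSet_le (by fun_prop) (by fun_prop))
      (measurableSet_lt (by fun_prop) (by fun_prop))
  have : ∀ p : ℝ × ℝ, qcJ p (s, t) = {p : ℝ × ℝ | p.1 ≤ s ∧ t < p.2}.indicator 1 p +
      {p : ℝ × ℝ | p.2 ≤ s ∧ t < p.1}.indicator 1 p := by
    intro p
    simp [qcJ, Set.indicator]
  simp_rw [this]
  rw [lintegral_add_left (measurable_one.indicator hA), lintegral_indicator_one hA,
    lintegral_indicator_one hB]
  simp only [qcD]
  rw [Measure.map_apply measurable_fst measurableSet_Iic,
    Measure.map_apply measurable_snd measurableSet_Iic,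
    ← measure_sdiff (by intro p hp; exact hp.1) (measurableSet_Iic.prod measurableSet_Iic).nullMeasurableSet
      (measure_ne_top _ _),
    ← measure_sdiff (by intro p hp; exact hp.2) (measurableSet_Iic.prod measurableSet_Iic).nullMeasurableSet
      (measure_ne_top _ _)]
  congr 2
  · ext p; simp [Prod.le_def]; grind
  · ext p; simp [Prod.le_def]; grind

/-- the quantile coupling and its distribution function -/
lemma quantile_le_iff (μ : Measure ℝ) [IsProbabilityMeasure μ] (u x : ℝ) (hu : u ∈ Set.Ioo (0:ℝ) 1) :
    quantileFn (cdf μ) u ≤ x ↔ u ≤ cdf μ x := by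
  have hne : {x | u ≤ cdf μ x}.Nonempty := by
    obtain ⟨y, hy⟩ := ((tendsto_cdf_atTop μ).eventually (lt_mem_nhds hu.2)).exists
    exact ⟨y, hy.le⟩
  have hbd : BddBelow {x | u ≤ cdf μ x} := by
    obtain ⟨y, hy⟩ := ((tendsto_cdf_atBot μ).eventually (gt_mem_nhds hu.1)).exists
    refine ⟨y, fun z hz => ?_⟩
    by_contra h
    have : cdf μ z ≤ cdf μ y := monotone_cdf μ (not_le.1 h).le
    have hz' : u ≤ cdf μ z := hz
    linarith
  constructor
  · intro h
    have hc : Tendsto (cdf μ) (nhdsWithin x (Set.Ioi x)) (nhds (cdf μ x)) :=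
      ((cdf μ).right_continuous x).tendsto.mono_left (nhdsWithin_mono _ Set.Ioi_subset_Ici_self)
    refine ge_of_tendsto hc ?_
    filter_upwards [self_mem_nhdsWithin] with y hy
    obtain ⟨z, hz, hzy⟩ := exists_lt_of_csInf_lt hne (lt_of_le_of_lt h hy)
    exact le_trans hz (monotone_cdf μ hzy.le)
  · intro h
    exact csInf_le hbd h

lemma quantile_aemeas (μ : Measure ℝ) [IsProbabilityMeasure μ] :
    AEMeasurable (quantileFn (cdf μ)) (volume.restrict (Set.Ioo (0:ℝ) 1)) := by
  refine aemeasurable_restrict_of_monotoneOn measurableSet_Ioo ?_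
  intro u hu v hv huv
  rw [quantile_le_iff μ u _ hu]
  exact huv.trans ((quantile_le_iff μ v _ hv).1 le_rfl)

def qcQ (μ ν : Measure ℝ) : Measure (ℝ × ℝ) :=
  (volume.restrict (Set.Ioo (0:ℝ) 1)).map (fun u => (quantileFn (cdf μ) u, quantileFn (cdf ν) u))

lemma unif_Iic (c : ℝ) (h0 : 0 ≤ c) (h1 : c ≤ 1) :
    volume (Set.Iic c ∩ Set.Ioo (0:ℝ) 1) = ENNReal.ofReal c := by
  apply le_antisymm
  · calc _ ≤ volume (Set.Ioc 0 c) := measure_mono (by intro x hx; exact ⟨hx.2.1, hx.1⟩)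
      _ = _ := by simp
  · calc ENNReal.ofReal c = volume (Set.Ioo 0 c) := by simp
      _ ≤ _ := measure_mono (by intro x hx; exact ⟨hx.2.le, hx.1, hx.2.trans_le h1⟩)

lemma quantile_map (μ : Measure ℝ) [IsProbabilityMeasure μ] :
    (volume.restrict (Set.Ioo (0:ℝ) 1)).map (quantileFn (cdf μ)) = μ := by
  refine Measure.ext_of_Iic _ _ fun x => ?_
  rw [Measure.map_apply_of_aemeasurable (quantile_aemeas μ) measurableSet_Iic,
    Measure.restrict_apply' measurableSet_Ioo, ← ofReal_cdf μ x,
    ← unif_Iic _ (cdf_nonneg μ x) (cdf_le_one μ x)]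
  congr 1
  ext u
  simp only [Set.mem_inter_iff, Set.mem_preimage, Set.mem_Iic]
  exact and_congr_left fun hu => quantile_le_iff μ u x hu

lemma qcQ_Iic (μ ν : Measure ℝ) [IsProbabilityMeasure μ] [IsProbabilityMeasure ν] (s t : ℝ) :
    qcQ μ ν (Set.Iic s ×ˢ Set.Iic t) = min (μ (Set.Iic s)) (ν (Set.Iic t)) := by
  rw [qcQ, Measure.map_apply_of_aemeasurable ((quantile_aemeas μ).prodMk (quantile_aemeas ν))
    (measurableSet_Iic.prod measurableSet_Iic),
    Measure.restrict_apply' measurableSet_Ioo, ← ofReal_cdf μ s, ← ofReal_cdf ν t,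
    ← ENNReal.ofReal_min,
    ← unif_Iic _ (le_min (cdf_nonneg μ s) (cdf_nonneg ν t)) ((min_le_left _ _).trans (cdf_le_one μ s))]
  congr 1
  ext u
  simp only [Set.mem_inter_iff, Set.mem_preimage, Set.mem_Iic, Set.mem_prod, le_min_iff]
  exact and_congr_left fun hu => and_congr (quantile_le_iff μ u s hu) (quantile_le_iff ν u t hu)

lemma qcQ_fst (μ ν : Measure ℝ) [IsProbabilityMeasure μ] [IsProbabilityMeasure ν] :
    (qcQ μ ν).map Prod.fst = μ := by
  rw [qcQ, AEMeasurable.map_map_of_aemeasurable measurable_fst.aemeasurable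
    ((quantile_aemeas μ).prodMk (quantile_aemeas ν))]
  exact quantile_map μ

lemma qcQ_snd (μ ν : Measure ℝ) [IsProbabilityMeasure μ] [IsProbabilityMeasure ν] :
    (qcQ μ ν).map Prod.snd = ν := by
  rw [qcQ, AEMeasurable.map_map_of_aemeasurable measurable_snd.aemeasurable
    ((quantile_aemeas μ).prodMk (quantile_aemeas ν))]
  exact quantile_map ν

instance (μ ν : Measure ℝ) : IsFiniteMeasure (qcQ μ ν) := by unfold qcQ; infer_instance

lemma qc_le (μ ν : Measure ℝ) (π : Measure (ℝ × ℝ))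
    (h1 : π.map Prod.fst = μ) (h2 : π.map Prod.snd = ν) (s t : ℝ) :
    π (Set.Iic s ×ˢ Set.Iic t) ≤ min (μ (Set.Iic s)) (ν (Set.Iic t)) := by
  rw [← h1, ← h2, Measure.map_apply measurable_fst measurableSet_Iic,
    Measure.map_apply measurable_snd measurableSet_Iic]
  exact le_min (measure_mono fun p hp => hp.1) (measure_mono fun p hp => hp.2)

lemma qcD_le (μ ν : Measure ℝ) [IsProbabilityMeasure μ] [IsProbabilityMeasure ν] (π : Measure (ℝ × ℝ))
    (h1 : π.map Prod.fst = μ) (h2 : π.map Prod.snd = ν) (q : ℝ × ℝ) :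
    qcD (qcQ μ ν) q ≤ qcD π q := by
  simp only [qcD, qcQ_fst, qcQ_snd, h1, h2, qcQ_Iic]
  exact add_le_add (tsub_le_tsub_left (qc_le μ ν π h1 h2 _ _) _)
    (tsub_le_tsub_left (qc_le μ ν π h1 h2 _ _) _)

lemma qc_opt (r : ℝ) (hr : 1 ≤ r) (μ ν : Measure ℝ) [IsProbabilityMeasure μ]
    [IsProbabilityMeasure ν] (π : Measure (ℝ × ℝ)) [IsFiniteMeasure π]
    (h1 : π.map Prod.fst = μ) (h2 : π.map Prod.snd = ν) :
    ∫⁻ p, ENNReal.ofReal (|p.1 - p.2| ^ r) ∂(qcQ μ ν) ≤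
      ∫⁻ p, ENNReal.ofReal (|p.1 - p.2| ^ r) ∂π := by
  rcases hr.eq_or_lt with rfl | hr
  · rw [qc_cost 1 _ qcJ_one, qc_cost 1 _ qcJ_one]
    exact lintegral_mono (qcD_le μ ν π h1 h2)
  · rw [qc_cost r _ (qcJ_gt r hr), qc_cost r _ (qcJ_gt r hr)]
    exact lintegral_mono (qcD_le μ ν π h1 h2)

lemma qcK_meas (π : Measure (ℝ × ℝ)) [IsFiniteMeasure π] :
    Measurable (fun q : ℝ × ℝ => π (Set.Iic q.1 ×ˢ Set.Iic q.2)) := by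
  have : MeasurableSet {z : (ℝ × ℝ) × (ℝ × ℝ) | z.2.1 ≤ z.1.1 ∧ z.2.2 ≤ z.1.2} :=
    qc_and (measurableSet_le (by fun_prop) (by fun_prop))
      (measurableSet_le (by fun_prop) (by fun_prop))
  exact measurable_measure_prodMk_left this

lemma qcD_meas (π : Measure (ℝ × ℝ)) [IsFiniteMeasure π] : Measurable (qcD π) := by
  have hmono : ∀ ρ : Measure ℝ, Measurable (fun q : ℝ × ℝ => ρ (Set.Iic q.1)) := fun ρ =>
    (Monotone.measurable (f := fun s => ρ (Set.Iic s))
      (fun s t h => measure_mono (Set.Iic_subset_Iic.2 h))).comp measurable_fst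
  unfold qcD
  exact ((hmono _).sub (qcK_meas π)).add ((hmono _).sub ((qcK_meas π).comp measurable_swap))

lemma qc_tsub {a k k' : ℝ≥0∞} (ha : a ≠ ∞) (hk : k ≤ a) (hk' : k' ≤ a) (h : a - k = a - k') :
    k = k' := by
  rw [← ENNReal.sub_sub_cancel ha hk, h, ENNReal.sub_sub_cancel ha hk']

lemma qc_add {a b c d : ℝ≥0∞} (h1 : a ≤ c) (h2 : b ≤ d) (hc : c ≠ ∞) (hd : d ≠ ∞)
    (h : a + b = c + d) : a = c ∧ b = d := by
  have ha := ne_top_of_le_ne_top hc h1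
  have hb := ne_top_of_le_ne_top hd h2
  lift a to ℝ≥0 using ha
  lift b to ℝ≥0 using hb
  lift c to ℝ≥0 using hc
  lift d to ℝ≥0 using hd
  norm_cast at *
  exact (add_eq_add_iff_eq_and_eq h1 h2).1 h

lemma qcD_eq (μ ν : Measure ℝ) [IsProbabilityMeasure μ] [IsProbabilityMeasure ν] (π : Measure (ℝ × ℝ))
    (h1 : π.map Prod.fst = μ) (h2 : π.map Prod.snd = ν) (q : ℝ × ℝ)
    (h : qcD (qcQ μ ν) q = qcD π q) :
    π (Set.Iic q.1 ×ˢ Set.Iic q.2) = min (μ (Set.Iic q.1)) (ν (Set.Iic q.2)) ∧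
    π (Set.Iic q.2 ×ˢ Set.Iic q.1) = min (μ (Set.Iic q.2)) (ν (Set.Iic q.1)) := by
  simp only [qcD, qcQ_fst, qcQ_snd, h1, h2, qcQ_Iic] at h
  have a1 := qc_le μ ν π h1 h2 q.1 q.2
  have a2 := qc_le μ ν π h1 h2 q.2 q.1
  have b1 := tsub_le_tsub_left a1 (μ (Set.Iic q.1))
  have b2 := tsub_le_tsub_left a2 (ν (Set.Iic q.1))
  have fμ : ∀ s, μ (Set.Iic s) ≠ ∞ := fun s => measure_ne_top _ _
  have fν : ∀ s, ν (Set.Iic s) ≠ ∞ := fun s => measure_ne_top _ _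
  have := qc_add b1 b2 (by finiteness) (by finiteness) h
  exact ⟨(qc_tsub (fμ q.1) (min_le_left _ _) (a1.trans (min_le_left _ _)) this.1).symm,
    (qc_tsub (fν q.1) (min_le_right _ _) (a2.trans (min_le_right _ _)) this.2).symm⟩

lemma qc_ext (π π' : Measure (ℝ × ℝ)) [IsProbabilityMeasure π] [IsProbabilityMeasure π']
    (h : ∀ s t, π (Set.Iic s ×ˢ Set.Iic t) = π' (Set.Iic s ×ˢ Set.Iic t)) : π = π' := by
  have hg : MeasurableSpace.generateFrom (Set.range (Set.Iic : ℝ → Set ℝ)) = borel ℝ :=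
    (borel_eq_generateFrom_Iic ℝ).symm
  have hs : IsCountablySpanning (Set.range (Set.Iic : ℝ → Set ℝ)) := by
    refine ⟨fun n : ℕ => Set.Iic (n : ℝ), fun n => ⟨_, rfl⟩, ?_⟩
    refine Set.eq_univ_of_forall fun x => ?_
    obtain ⟨n, hn⟩ := exists_nat_ge x
    exact Set.mem_iUnion.2 ⟨n, hn⟩
  have hg' : MeasurableSpace.generateFrom (Set.range (Set.Iic : ℝ → Set ℝ)) =
      (inferInstance : MeasurableSpace ℝ) := hg.trans (BorelSpace.measurable_eq).symm
  refine ext_of_generate_finite _ (generateFrom_eq_prod hg' hg' hs hs).symm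
    (isPiSystem_Iic.prod isPiSystem_Iic) ?_ (by simp)
  rintro _ ⟨_, ⟨s, rfl⟩, _, ⟨t, rfl⟩, rfl⟩
  exact h s t

lemma qc_unique (r : ℝ) (hr : 1 < r) (μ ν : Measure ℝ) [IsProbabilityMeasure μ]
    [IsProbabilityMeasure ν] (π : Measure (ℝ × ℝ)) [IsProbabilityMeasure π]
    (h1 : π.map Prod.fst = μ) (h2 : π.map Prod.snd = ν)
    (hfin : ∫⁻ p, ENNReal.ofReal (|p.1 - p.2| ^ r) ∂π ≠ ∞)
    (heq : ∫⁻ p, ENNReal.ofReal (|p.1 - p.2| ^ r) ∂(qcQ μ ν) =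
      ∫⁻ p, ENNReal.ofReal (|p.1 - p.2| ^ r) ∂π) : π = qcQ μ ν := by
  haveI : IsProbabilityMeasure (qcQ μ ν) := by
    constructor
    rw [← Set.preimage_univ (f := Prod.fst), ← Measure.map_apply measurable_fst MeasurableSet.univ,
      qcQ_fst, measure_univ]
  rw [← heq] at hfin
  rw [qc_cost r _ (qcJ_gt r hr)] at heq hfin
  rw [qc_cost r _ (qcJ_gt r hr)] at heq
  have hae := ae_eq_of_ae_le_of_lintegral_le (ae_of_all _ (qcD_le μ ν π h1 h2)) hfin
    (qcD_meas π).aemeasurable heq.ge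
  rw [Filter.EventuallyEq, ae_withDensity_iff (qcDens_meas r)] at hae
  have hlt : ∀ᵐ q : ℝ × ℝ, q.1 < q.2 →
      (π (Set.Iic q.1 ×ˢ Set.Iic q.2) = min (μ (Set.Iic q.1)) (ν (Set.Iic q.2)) ∧
       π (Set.Iic q.2 ×ˢ Set.Iic q.1) = min (μ (Set.Iic q.2)) (ν (Set.Iic q.1))) := by
    filter_upwards [hae] with q hq hlt
    refine qcD_eq μ ν π h1 h2 q (hq ?_)
    simp only [qcDens, hlt, if_true, ne_eq, ENNReal.ofReal_eq_zero, not_le]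
    have : 0 < q.2 - q.1 := by linarith
    have : 0 < r - 1 := by linarith
    positivity
  have hgt : ∀ᵐ q : ℝ × ℝ, q.2 < q.1 →
      (π (Set.Iic q.2 ×ˢ Set.Iic q.1) = min (μ (Set.Iic q.2)) (ν (Set.Iic q.1)) ∧
       π (Set.Iic q.1 ×ˢ Set.Iic q.2) = min (μ (Set.Iic q.1)) (ν (Set.Iic q.2))) :=
    (Measure.measurePreserving_swap (μ := (volume : Measure ℝ)) (ν := (volume : Measure ℝ))).quasiMeasurePreserving.ae hlt
  have hne : ∀ᵐ q : ℝ × ℝ, q.1 ≠ q.2 := by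
    rw [Measure.volume_eq_prod]
    refine (Measure.ae_prod_iff_ae_ae ?_).2 (ae_of_all _ fun s => ?_)
    · exact (measurableSet_eq_fun measurable_fst measurable_snd).compl
    · filter_upwards [Measure.ae_ne volume s] with t ht using ht.symm
  have hall : ∀ᵐ q : ℝ × ℝ,
      π (Set.Iic q.1 ×ˢ Set.Iic q.2) = min (μ (Set.Iic q.1)) (ν (Set.Iic q.2)) := by
    filter_upwards [hlt, hgt, hne] with q a b c
    rcases lt_or_gt_of_ne c with c | c
    · exact (a c).1
    · exact (b c).2
  refine qc_ext _ _ fun a b => ?_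
  rw [qcQ_Iic]
  refine le_antisymm (qc_le μ ν π h1 h2 a b) ?_
  let e : ℕ → ℝ := fun n => 1 / ((n : ℝ) + 1)
  have he : ∀ n, 0 < e n := fun n => Nat.one_div_pos_of_nat
  have hanti : Antitone e := fun m n h => Nat.one_div_le_one_div h
  have het : Tendsto e atTop (nhds 0) := tendsto_one_div_add_atTop_nhds_zero_nat
  have hT := tendsto_measure_iInter_atTop (μ := π)
    (s := fun n => Set.Iic (a + e n) ×ˢ Set.Iic (b + e n))
    (fun n => (measurableSet_Iic.prod measurableSet_Iic).nullMeasurableSet)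
    (fun m n h => Set.prod_mono (Set.Iic_subset_Iic.2 (by linarith [hanti h]))
      (Set.Iic_subset_Iic.2 (by linarith [hanti h]))) ⟨0, measure_ne_top _ _⟩
  have hI : ⋂ n, Set.Iic (a + e n) ×ˢ Set.Iic (b + e n) = Set.Iic a ×ˢ Set.Iic b := by
    ext ⟨x, y⟩
    simp only [Set.mem_iInter, Set.mem_prod, Set.mem_Iic]
    constructor
    · intro h
      exact ⟨ge_of_tendsto' (by simpa using het.const_add a) fun n => (h n).1,
        ge_of_tendsto' (by simpa using het.const_add b) fun n => (h n).2⟩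
    · intro h n
      exact ⟨by linarith [he n, h.1], by linarith [he n, h.2]⟩
  rw [hI] at hT
  refine ge_of_tendsto' hT fun n => ?_
  have hpos : volume (Set.Ioo a (a + e n) ×ˢ Set.Ioo b (b + e n)) ≠ 0 := by
    rw [Measure.volume_eq_prod, Measure.prod_prod]
    simp [he n]
  obtain ⟨q, hq, hq'⟩ : ∃ q ∈ Set.Ioo a (a + e n) ×ˢ Set.Ioo b (b + e n),
      π (Set.Iic q.1 ×ˢ Set.Iic q.2) = min (μ (Set.Iic q.1)) (ν (Set.Iic q.2)) := by
    by_contra! hcon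
    refine hpos (measure_mono_null ?_ (ae_iff.1 hall))
    exact fun q hq => hcon q hq
  calc min (μ (Set.Iic a)) (ν (Set.Iic b)) ≤ min (μ (Set.Iic q.1)) (ν (Set.Iic q.2)) :=
        min_le_min (measure_mono (Set.Iic_subset_Iic.2 hq.1.1.le))
          (measure_mono (Set.Iic_subset_Iic.2 hq.2.1.le))
    _ = π (Set.Iic q.1 ×ˢ Set.Iic q.2) := hq'.symm
    _ ≤ _ := measure_mono (Set.prod_mono (Set.Iic_subset_Iic.2 hq.1.2.le)
      (Set.Iic_subset_Iic.2 hq.2.2.le))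

/-- **Optimality of the quantile coupling.**  Let `r ≥ 1` and let `X, Y` be random
variables with finite absolute `r`-th moments, defined on a common probability space
(so `(X,Y)` is a coupling of the two marginal laws).  With `U` uniform on `(0,1)`,
`X* = F_X⁻¹(U)` and `Y* = F_Y⁻¹(U)`, one has `E|X−Y|^r ≥ E|X*−Y*|^r`; if `r > 1`,
equality forces `(X,Y)` to have the joint law of `(X*,Y*)`; and the quantile coupling
attains the infimum defining the Mallows `r`-distance. -/
theorem quantile_coupling_optimal
    {Ω : Type*} [MeasureSpace Ω] [IsProbabilityMeasure (ℙ : Measure Ω)]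
    (r : ℝ) (hr : 1 ≤ r)
    (X Y : Ω → ℝ) (hX : Measurable X) (hY : Measurable Y)
    (hXr : ∫⁻ ω, ENNReal.ofReal (|X ω| ^ r) ∂ℙ ≠ ∞)
    (hYr : ∫⁻ ω, ENNReal.ofReal (|Y ω| ^ r) ∂ℙ ≠ ∞)
    (U : Measure ℝ) (hU : U = volume.restrict (Set.Ioo (0:ℝ) 1))
    (Xs Ys : ℝ → ℝ)
    (hXs : ∀ u, Xs u = quantileFn (cdf ((ℙ : Measure Ω).map X)) u)
    (hYs : ∀ u, Ys u = quantileFn (cdf ((ℙ : Measure Ω).map Y)) u) :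
    (∫⁻ u, ENNReal.ofReal (|Xs u - Ys u| ^ r) ∂U ≤
        ∫⁻ ω, ENNReal.ofReal (|X ω - Y ω| ^ r) ∂ℙ) ∧
    (1 < r →
      (∫⁻ u, ENNReal.ofReal (|Xs u - Ys u| ^ r) ∂U =
          ∫⁻ ω, ENNReal.ofReal (|X ω - Y ω| ^ r) ∂ℙ) →
      (ℙ : Measure Ω).map (fun ω => (X ω, Y ω)) =
        U.map (fun u => (Xs u, Ys u))) ∧
    mallows r ((ℙ : Measure Ω).map X) ((ℙ : Measure Ω).map Y) =
      (∫⁻ u, ENNReal.ofReal (|Xs u - Ys u| ^ r) ∂U) ^ (1 / r) := by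
  have hcost : Measurable (fun p : ℝ × ℝ => ENNReal.ofReal (|p.1 - p.2| ^ r)) := by fun_prop
  haveI : IsProbabilityMeasure ((ℙ : Measure Ω).map X) :=
    Measure.isProbabilityMeasure_map hX.aemeasurable
  haveI : IsProbabilityMeasure ((ℙ : Measure Ω).map Y) :=
    Measure.isProbabilityMeasure_map hY.aemeasurable
  have hXY : Measurable (fun ω => (X ω, Y ω)) := hX.prodMk hY
  haveI : IsProbabilityMeasure ((ℙ : Measure Ω).map (fun ω => (X ω, Y ω))) :=
    Measure.isProbabilityMeasure_map hXY.aemeasurable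
  obtain rfl : Xs = _ := funext hXs
  obtain rfl : Ys = _ := funext hYs
  subst hU
  set μ := (ℙ : Measure Ω).map X with hμ
  set ν := (ℙ : Measure Ω).map Y with hν
  set π := (ℙ : Measure Ω).map (fun ω => (X ω, Y ω)) with hπ
  have h1 : π.map Prod.fst = μ := by
    rw [hπ, Measure.map_map measurable_fst hXY]; rfl
  have h2 : π.map Prod.snd = ν := by
    rw [hπ, Measure.map_map measurable_snd hXY]; rfl
  have eQ : ∫⁻ u in Set.Ioo (0:ℝ) 1,
      ENNReal.ofReal (|quantileFn (cdf μ) u - quantileFn (cdf ν) u| ^ r) =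
      ∫⁻ p, ENNReal.ofReal (|p.1 - p.2| ^ r) ∂(qcQ μ ν) := by
    rw [qcQ, lintegral_map' hcost.aemeasurable ((quantile_aemeas μ).prodMk (quantile_aemeas ν))]
  have eP : ∫⁻ ω, ENNReal.ofReal (|X ω - Y ω| ^ r) ∂ℙ =
      ∫⁻ p, ENNReal.ofReal (|p.1 - p.2| ^ r) ∂π := by
    rw [hπ, lintegral_map hcost hXY]
  have hfin : ∫⁻ ω, ENNReal.ofReal (|X ω - Y ω| ^ r) ∂ℙ ≠ ∞ := by
    have hb : ∀ x y : ℝ, ENNReal.ofReal (|x - y| ^ r) ≤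
        ENNReal.ofReal (2 ^ r) * (ENNReal.ofReal (|x| ^ r) + ENNReal.ofReal (|y| ^ r)) := by
      intro x y
      rw [← ENNReal.ofReal_add (by positivity) (by positivity), ← ENNReal.ofReal_mul (by positivity)]
      refine ENNReal.ofReal_le_ofReal ?_
      have h0 : |x - y| ≤ 2 * max |x| |y| := by
        have := abs_sub x y
        linarith [le_max_left |x| |y|, le_max_right |x| |y|]
      calc |x - y| ^ r ≤ (2 * max |x| |y|) ^ r :=
            Real.rpow_le_rpow (abs_nonneg _) h0 (by linarith)
        _ = 2 ^ r * (max |x| |y|) ^ r := Real.mul_rpow (by norm_num) (by positivity)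
        _ ≤ _ := by
          refine mul_le_mul_of_nonneg_left ?_ (by positivity)
          have hx : 0 ≤ |x| ^ r := by positivity
          have hy : 0 ≤ |y| ^ r := by positivity
          rcases max_choice |x| |y| with h | h <;> rw [h] <;> linarith
    refine ne_top_of_le_ne_top ?_ (lintegral_mono fun ω => hb (X ω) (Y ω))
    rw [lintegral_const_mul _ (by fun_prop), lintegral_add_left (by fun_prop)]
    finiteness
  refine ⟨?_, ?_, ?_⟩
  · rw [eQ, eP]
    exact qc_opt r hr μ ν π h1 h2
  · intro hr' heq
    rw [eQ, eP] at heq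
    rw [eP] at hfin
    exact qc_unique r hr' μ ν π h1 h2 hfin heq
  · rw [eQ, mallows]
    congr 1
    refine le_antisymm (iInf₂_le (qcQ μ ν) ⟨qcQ_fst μ ν, qcQ_snd μ ν⟩) (le_iInf₂ fun ρ hρ => ?_)
    haveI : IsFiniteMeasure ρ := by
      constructor
      rw [← Set.preimage_univ (f := Prod.fst), ← Measure.map_apply measurable_fst MeasurableSet.univ,
        hρ.1]
      exact measure_lt_top _ _
    exact qc_opt r hr μ ν ρ hρ.1 hρ.2
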